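/- The R-matrix of U_q(osp(1,2)^) satisfies the ℤ/2-graded Yang–Baxter equation: over the field ℚ(p,z,w) (with q = p²), the 27×27 matrix identity R₁₂(z)·R₁₃(zw)·R₂₃(w) = R₂₃(w)·R₁₃(zw)·R₁₂(z) holds, where R₁₂(x) = R(x) ⊗ I₃ and R₂₃(x) = I₃ ⊗ R(x) are ordinary Kronecker products, and R₁₃(x) is the 27×27 matrix with entries (R₁₃(x))_{(α,β,γ),(α',β',γ')} = δ_{β,β'}·(−1)^{([γ]+[γ'])·[β]}·R(x)_{(α,γ),(α',γ')}, the sign factor encoding the graded tensor multiplication (a⊗b)(a'⊗b') = (−1)^{[b][a']} aa'⊗bb'. -/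

import Mathlib

/-- The ℤ/2-grading on the index set {1,2,3} (0-based: indices 0,2 even, index 1 odd). -/
def par (i : Fin 3) : ℕ := if i = 1 then 1 else 0

/-- The R-matrix `R(x)` of `U_q(osp(1,2)^)` over a field `K`, with `q = p^2` and
spectral parameter `x` (i.e. `z = x`, `w = 1`), indexed by pairs in `{1,2,3} × {1,2,3}`
(written 0-based as `Fin 3 × Fin 3`). -/
noncomputable def Rmat {K : Type*} [Field K] (p x : K) :
    Matrix (Fin 3 × Fin 3) (Fin 3 × Fin 3) K :=
  let q := p ^ 2
  let z := x
  let w : K := 1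
  let a := q * (z - w) / (z * q ^ 2 - w)
  let b := w * (q ^ 2 - 1) / (z * q ^ 2 - w)
  let c := p * w * (q ^ 2 - 1) * (z - w) / ((z * q ^ 2 - w) * (z * q ^ 3 - w))
  let d := q ^ 2 * (z - w) * (z * q - w) / ((z * q ^ 2 - w) * (z * q ^ 3 - w))
  let e := a - z * w * (q ^ 2 - 1) * (q ^ 3 - 1) / ((z * q ^ 2 - w) * (z * q ^ 3 - w))
  let f := z * (q ^ 2 - 1) / (z * q ^ 2 - w)
  let g := -(p ^ 5) * z * (q ^ 2 - 1) * (z - w) / ((z * q ^ 2 - w) * (z * q ^ 3 - w))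
  let r := w * (q ^ 2 - 1) * (q ^ 3 * z + q * (z - w) - w) / ((z * q ^ 2 - w) * (z * q ^ 3 - w))
  let s := z * (q ^ 2 - 1) * (q ^ 3 * z + q ^ 2 * (z - w) - w) / ((z * q ^ 2 - w) * (z * q ^ 3 - w))
  Matrix.of fun i j : Fin 3 × Fin 3 =>
    if i = (0, 0) ∧ j = (0, 0) then 1
    else if i = (2, 2) ∧ j = (2, 2) then 1
    else if i = (0, 1) ∧ j = (0, 1) then a
    else if i = (1, 0) ∧ j = (1, 0) then a
    else if i = (1, 2) ∧ j = (1, 2) then a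
    else if i = (2, 1) ∧ j = (2, 1) then a
    else if i = (0, 1) ∧ j = (1, 0) then b
    else if i = (1, 2) ∧ j = (2, 1) then b
    else if i = (1, 0) ∧ j = (0, 1) then f
    else if i = (2, 1) ∧ j = (1, 2) then f
    else if i = (0, 2) ∧ j = (0, 2) then d
    else if i = (2, 0) ∧ j = (2, 0) then d
    else if i = (0, 2) ∧ j = (1, 1) then c
    else if i = (1, 1) ∧ j = (2, 0) then c
    else if i = (1, 1) ∧ j = (0, 2) then g
    else if i = (2, 0) ∧ j = (1, 1) then g
    else if i = (1, 1) ∧ j = (1, 1) then e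
    else if i = (0, 2) ∧ j = (2, 0) then r
    else if i = (2, 0) ∧ j = (0, 2) then s
    else 0

/-- `R₁₂(x) = R(x) ⊗ I₃`, acting on the first two factors of `V ⊗ V ⊗ V`. -/
noncomputable def R12 {K : Type*} [Field K]
    (R : Matrix (Fin 3 × Fin 3) (Fin 3 × Fin 3) K) :
    Matrix (Fin 3 × Fin 3 × Fin 3) (Fin 3 × Fin 3 × Fin 3) K :=
  Matrix.of fun i j => R (i.1, i.2.1) (j.1, j.2.1) * (if i.2.2 = j.2.2 then 1 else 0)

/-- `R₂₃(x) = I₃ ⊗ R(x)`, acting on the last two factors of `V ⊗ V ⊗ V`. -/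
noncomputable def R23 {K : Type*} [Field K]
    (R : Matrix (Fin 3 × Fin 3) (Fin 3 × Fin 3) K) :
    Matrix (Fin 3 × Fin 3 × Fin 3) (Fin 3 × Fin 3 × Fin 3) K :=
  Matrix.of fun i j => (if i.1 = j.1 then 1 else 0) * R (i.2.1, i.2.2) (j.2.1, j.2.2)

/-- `R₁₃(x)`, acting on the outer factors of `V ⊗ V ⊗ V`, with the sign
`(−1)^(([γ]+[γ'])·[β])` encoding the graded tensor multiplication
`(a⊗b)(a'⊗b') = (−1)^{[b][a']} aa'⊗bb'`. -/
noncomputable def R13 {K : Type*} [Field K]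
    (R : Matrix (Fin 3 × Fin 3) (Fin 3 × Fin 3) K) :
    Matrix (Fin 3 × Fin 3 × Fin 3) (Fin 3 × Fin 3 × Fin 3) K :=
  Matrix.of fun i j =>
    (if i.2.1 = j.2.1 then 1 else 0) *
      (-1 : K) ^ ((par i.2.2 + par j.2.2) * par i.2.1) * R (i.1, i.2.2) (j.1, j.2.2)

/-- The field `ℚ(p, z, w)` of rational functions over `ℚ` in three variables. -/
abbrev F3 : Type := FractionRing (MvPolynomial (Fin 3) ℚ)

/-- The variable `p` (with `q = p^2`) in `ℚ(p, z, w)`. -/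
noncomputable def pv : F3 := algebraMap (MvPolynomial (Fin 3) ℚ) F3 (MvPolynomial.X 0)

/-- The spectral-parameter variable `z` in `ℚ(p, z, w)`. -/
noncomputable def zv : F3 := algebraMap (MvPolynomial (Fin 3) ℚ) F3 (MvPolynomial.X 1)

/-- The spectral-parameter variable `w` in `ℚ(p, z, w)`. -/
noncomputable def wv : F3 := algebraMap (MvPolynomial (Fin 3) ℚ) F3 (MvPolynomial.X 2)

/-- The action on functions of two indices of `R(x)` multiplied by the common denominator
`(x q² - 1) (x q³ - 1)` of its entries, where `q = p²`. -/
def clearedAction {K : Type*} [Field K] (p x : K) (φ : Fin 3 → Fin 3 → K) (i j : Fin 3) : K :=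
  match i, j with
  | 0, 0 => (x * p ^ 4 - 1) * (x * p ^ 6 - 1) * φ 0 0
  | 2, 2 => (x * p ^ 4 - 1) * (x * p ^ 6 - 1) * φ 2 2
  | 0, 1 => (x * p ^ 6 - 1) * (p ^ 2 * (x - 1) * φ 0 1 + (p ^ 4 - 1) * φ 1 0)
  | 1, 0 => (x * p ^ 6 - 1) * (p ^ 2 * (x - 1) * φ 1 0 + x * (p ^ 4 - 1) * φ 0 1)
  | 1, 2 => (x * p ^ 6 - 1) * (p ^ 2 * (x - 1) * φ 1 2 + (p ^ 4 - 1) * φ 2 1)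
  | 2, 1 => (x * p ^ 6 - 1) * (p ^ 2 * (x - 1) * φ 2 1 + x * (p ^ 4 - 1) * φ 1 2)
  | 0, 2 => p ^ 4 * (x - 1) * (x * p ^ 2 - 1) * φ 0 2 + p * (p ^ 4 - 1) * (x - 1) * φ 1 1 +
      (p ^ 4 - 1) * (p ^ 6 * x + p ^ 2 * (x - 1) - 1) * φ 2 0
  | 1, 1 => -p ^ 5 * x * (p ^ 4 - 1) * (x - 1) * φ 0 2 +
      (p ^ 2 * (x - 1) * (x * p ^ 6 - 1) - x * (p ^ 4 - 1) * (p ^ 6 - 1)) * φ 1 1 +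
      p * (p ^ 4 - 1) * (x - 1) * φ 2 0
  | 2, 0 => x * (p ^ 4 - 1) * (p ^ 6 * x + p ^ 4 * (x - 1) - 1) * φ 0 2 +
      -p ^ 5 * x * (p ^ 4 - 1) * (x - 1) * φ 1 1 + p ^ 4 * (x - 1) * (x * p ^ 2 - 1) * φ 2 0

theorem forall_fin_three {P : Fin 3 → Prop} (h₀ : P 0) (h₁ : P 1) (h₂ : P 2) (i : Fin 3) :
    P i := by
  fin_cases i <;> assumption

set_option maxHeartbeats 1000000 in
theorem sum_Rmat_mul {K : Type*} [Field K] {p x : K}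
    (h₄ : x * p ^ 4 - 1 ≠ 0) (h₆ : x * p ^ 6 - 1 ≠ 0)
    (φ : Fin 3 → Fin 3 → K) (i j : Fin 3) :
    ∑ k, ∑ l, Rmat p x (i, j) (k, l) * φ k l =
      ((x * p ^ 4 - 1) * (x * p ^ 6 - 1))⁻¹ * clearedAction p x φ i j := by
  have h₄' : p ^ 4 * x - 1 ≠ 0 := by rwa [mul_comm]
  have h₆' : p ^ 6 * x - 1 ≠ 0 := by rwa [mul_comm]
  revert i j
  refine forall_fin_three ?_ ?_ ?_ <;> refine forall_fin_three ?_ ?_ ?_ <;>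
    simp [Fin.sum_univ_three, Rmat, clearedAction, ← pow_mul] <;> field_simp <;> ring

theorem R12_mulVec {K : Type*} [Field K] (A : Matrix (Fin 3 × Fin 3) (Fin 3 × Fin 3) K)
    (φ : Fin 3 × Fin 3 × Fin 3 → K) (i j k : Fin 3) :
    (R12 A).mulVec φ (i, j, k) = ∑ s, ∑ t, A (i, j) (s, t) * φ (s, t, k) := by
  simp [Matrix.mulVec, dotProduct, R12, Fintype.sum_prod_type]

theorem R23_mulVec {K : Type*} [Field K] (A : Matrix (Fin 3 × Fin 3) (Fin 3 × Fin 3) K)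
    (φ : Fin 3 × Fin 3 × Fin 3 → K) (i j k : Fin 3) :
    (R23 A).mulVec φ (i, j, k) = ∑ s, ∑ t, A (j, k) (s, t) * φ (i, s, t) := by
  simp only [Matrix.mulVec, dotProduct, R23, Fintype.sum_prod_type, Matrix.of_apply]
  rw [Finset.sum_eq_single i] <;> simp +contextual [eq_comm]

theorem R13_mulVec {K : Type*} [Field K] (A : Matrix (Fin 3 × Fin 3) (Fin 3 × Fin 3) K)
    (φ : Fin 3 × Fin 3 × Fin 3 → K) (i j k : Fin 3) :
    (R13 A).mulVec φ (i, j, k) =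
      ∑ s, ∑ t, A (i, k) (s, t) * ((-1) ^ ((par k + par t) * par j) * φ (s, j, t)) := by
  simp only [Matrix.mulVec, dotProduct, R13, Fintype.sum_prod_type, Matrix.of_apply]
  refine Finset.sum_congr rfl fun s _ => ?_
  rw [Finset.sum_eq_single j]
  · refine Finset.sum_congr rfl fun t _ => ?_
    simp only [if_true]
    ring
  · simp +contextual [eq_comm]
  · simp

theorem clearedAction_const_mul {K : Type*} [Field K] (p x c : K) (φ : Fin 3 → Fin 3 → K)
    (i j : Fin 3) :
    clearedAction p x (fun s t => c * φ s t) i j = c * clearedAction p x φ i j := by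
  revert i j
  refine forall_fin_three ?_ ?_ ?_ <;> refine forall_fin_three ?_ ?_ ?_ <;>
    simp only [clearedAction] <;> ring

set_option maxHeartbeats 4000000 in
theorem clearedAction_yang_baxter {K : Type*} [Field K] (p x y : K)
    (φ : Fin 3 → Fin 3 → Fin 3 → K) (i j k : Fin 3) :
    clearedAction p x (fun i j => clearedAction p (x * y)
        (fun s u => (-1) ^ ((par k + par u) * par j) *
          clearedAction p y (fun t u => φ s t u) j u) i k) i j =
      clearedAction p y (fun j k => clearedAction p (x * y)
        (fun s u => (-1) ^ ((par k + par u) * par j) *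
          clearedAction p x (fun s t => φ s t u) s j) i k) j k := by
  revert i j k
  refine forall_fin_three ?_ ?_ ?_ <;> refine forall_fin_three ?_ ?_ ?_ <;>
    refine forall_fin_three ?_ ?_ ?_ <;> simp [clearedAction, par] <;> ring

theorem R12_Rmat_mulVec {K : Type*} [Field K] {p x : K}
    (h₄ : x * p ^ 4 - 1 ≠ 0) (h₆ : x * p ^ 6 - 1 ≠ 0)
    (φ : Fin 3 × Fin 3 × Fin 3 → K) (i j k : Fin 3) :
    (R12 (Rmat p x)).mulVec φ (i, j, k) =
      ((x * p ^ 4 - 1) * (x * p ^ 6 - 1))⁻¹ *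
        clearedAction p x (fun s t => φ (s, t, k)) i j := by
  rw [R12_mulVec, sum_Rmat_mul h₄ h₆ fun s t => φ (s, t, k)]

theorem R23_Rmat_mulVec {K : Type*} [Field K] {p x : K}
    (h₄ : x * p ^ 4 - 1 ≠ 0) (h₆ : x * p ^ 6 - 1 ≠ 0)
    (φ : Fin 3 × Fin 3 × Fin 3 → K) (i j k : Fin 3) :
    (R23 (Rmat p x)).mulVec φ (i, j, k) =
      ((x * p ^ 4 - 1) * (x * p ^ 6 - 1))⁻¹ *
        clearedAction p x (fun t u => φ (i, t, u)) j k := by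
  rw [R23_mulVec, sum_Rmat_mul h₄ h₆ fun t u => φ (i, t, u)]

theorem R13_Rmat_mulVec {K : Type*} [Field K] {p x : K}
    (h₄ : x * p ^ 4 - 1 ≠ 0) (h₆ : x * p ^ 6 - 1 ≠ 0)
    (φ : Fin 3 × Fin 3 × Fin 3 → K) (i j k : Fin 3) :
    (R13 (Rmat p x)).mulVec φ (i, j, k) =
      ((x * p ^ 4 - 1) * (x * p ^ 6 - 1))⁻¹ *
        clearedAction p x
          (fun s u => (-1) ^ ((par k + par u) * par j) * φ (s, j, u)) i k := by
  rw [R13_mulVec, sum_Rmat_mul h₄ h₆ fun s u => (-1) ^ ((par k + par u) * par j) * φ (s, j, u)]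

theorem Rmat_yang_baxter_of_ne_zero {K : Type*} [Field K] {p x y : K}
    (hx₄ : x * p ^ 4 - 1 ≠ 0) (hx₆ : x * p ^ 6 - 1 ≠ 0)
    (hy₄ : y * p ^ 4 - 1 ≠ 0) (hy₆ : y * p ^ 6 - 1 ≠ 0)
    (hxy₄ : x * y * p ^ 4 - 1 ≠ 0) (hxy₆ : x * y * p ^ 6 - 1 ≠ 0) :
    R12 (Rmat p x) * R13 (Rmat p (x * y)) * R23 (Rmat p y) =
      R23 (Rmat p y) * R13 (Rmat p (x * y)) * R12 (Rmat p x) := by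
  refine Matrix.mulVec_injective (funext fun φ => funext fun ⟨i, j, k⟩ => ?_)
  simp only [← Matrix.mulVec_mulVec, R12_Rmat_mulVec hx₄ hx₆, R23_Rmat_mulVec hy₄ hy₆,
    R13_Rmat_mulVec hxy₄ hxy₆, mul_left_comm ((-1 : K) ^ _), clearedAction_const_mul]
  rw [clearedAction_yang_baxter p x y (fun s t u => φ (s, t, u))]
  ring

open MvPolynomial in
theorem algebraMap_sub_one_ne_zero {f : MvPolynomial (Fin 3) ℚ} (hf : constantCoeff f = 0) :
    algebraMap (MvPolynomial (Fin 3) ℚ) F3 f - 1 ≠ 0 := by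
  rw [← map_one (algebraMap (MvPolynomial (Fin 3) ℚ) F3), sub_ne_zero]
  intro h
  simpa [hf] using congrArg constantCoeff (IsFractionRing.injective (MvPolynomial (Fin 3) ℚ) F3 h)

/-- the R-matrix of `U_q(osp(1,2)^)` satisfies the ℤ/2-graded Yang–Baxter
equation `R₁₂(z) R₁₃(zw) R₂₃(w) = R₂₃(w) R₁₃(zw) R₁₂(z)` over `ℚ(p, z, w)`. -/
theorem Rmat_graded_yang_baxter :
    R12 (Rmat pv zv) * R13 (Rmat pv (zv * wv)) * R23 (Rmat pv wv)
      = R23 (Rmat pv wv) * R13 (Rmat pv (zv * wv)) * R12 (Rmat pv zv) := by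
  apply Rmat_yang_baxter_of_ne_zero <;> simp only [pv, zv, wv, ← map_mul, ← map_pow] <;>
    exact algebraMap_sub_one_ne_zero (by simp)
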